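/- Let λ₁, λ₂, λ₃ ∈ ℝ, let [·,·] be the Table 1 bracket on ℝ⁶, g the Norden metric, R(x,y,z,u) := −(1/4)·g([x,y],[z,u]) the curvature tensor, εᵢ := g(eᵢ,eᵢ), and ρ(y,z) := Σ_{i=1}^{6} εᵢ·R(eᵢ,y,z,eᵢ) the Ricci tensor. Then: ρ(e₁,e₁) = ρ(e₄,e₄) = −ρ(e₁,e₄) = −λ₃², ρ(e₂,e₂) = ρ(e₅,e₅) = −ρ(e₂,e₅) = −λ₂², ρ(e₃,e₃) = ρ(e₆,e₆) = −ρ(e₃,e₆) = −λ₁², ρ(e₁,e₂) = −ρ(e₁,e₅) = −ρ(e₂,e₄) = ρ(e₄,e₅) = λ₂λ₃, ρ(e₁,e₃) = −ρ(e₁,e₆) = −ρ(e₃,e₄) = ρ(e₄,e₆) = λ₁λ₃, and ρ(e₂,e₃) = −ρ(e₂,e₆) = −ρ(e₃,e₅) = ρ(e₅,e₆) = λ₁λ₂. -/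

import Mathlib

noncomputable section

open Finset

/-- Component `k` of the Table 1 bracket `[e_i, e_j]` (indices 0–5 for e₁–e₆). -/
def tbl (l1 l2 l3 : ℝ) : Fin 6 → Fin 6 → Fin 6 → ℝ :=
  let v12 : Fin 6 → ℝ := ![0, 0, 0, l2, l3, 0]
  let v13 : Fin 6 → ℝ := ![0, 0, 0, -l1, 0, -l3]
  let v14 : Fin 6 → ℝ := ![0, l2, -l1, 0, l2, -l1]
  let v15 : Fin 6 → ℝ := ![0, l3, 0, -l2, 0, 0]
  let v16 : Fin 6 → ℝ := ![0, 0, -l3, l1, 0, 0]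
  let v23 : Fin 6 → ℝ := ![0, 0, 0, 0, l1, l2]
  let v24 : Fin 6 → ℝ := ![-l2, 0, 0, 0, l3, 0]
  let v25 : Fin 6 → ℝ := ![-l3, 0, l1, -l3, 0, l1]
  let v26 : Fin 6 → ℝ := ![0, 0, l2, 0, -l1, 0]
  let v34 : Fin 6 → ℝ := ![l1, 0, 0, 0, 0, -l3]
  let v35 : Fin 6 → ℝ := ![0, -l1, 0, 0, 0, l2]
  let v36 : Fin 6 → ℝ := ![l3, -l2, 0, l3, -l2, 0]
  let v45 : Fin 6 → ℝ := ![-l2, -l3, 0, 0, 0, 0]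
  let v46 : Fin 6 → ℝ := ![l1, 0, l3, 0, 0, 0]
  let v56 : Fin 6 → ℝ := ![0, -l1, -l2, 0, 0, 0]
  ![![0, v12, v13, v14, v15, v16],
    ![-v12, 0, v23, v24, v25, v26],
    ![-v13, -v23, 0, v34, v35, v36],
    ![-v14, -v24, -v34, 0, v45, v46],
    ![-v15, -v25, -v35, -v45, 0, v56],
    ![-v16, -v26, -v36, -v46, -v56, 0]]

/-- The Table 1 bracket on ℝ⁶, extended bilinearly. -/
def br (l1 l2 l3 : ℝ) (x y : Fin 6 → ℝ) : Fin 6 → ℝ :=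
  fun k => ∑ i : Fin 6, ∑ j : Fin 6, x i * y j * tbl l1 l2 l3 i j k

/-- The standard basis of ℝ⁶. -/
def e (i : Fin 6) : Fin 6 → ℝ := Pi.single i 1

/-- The signs of the Norden metric. -/
def eps : Fin 6 → ℝ := ![1, 1, 1, -1, -1, -1]

/-- The Norden metric: diagonal with entries (1,1,1,-1,-1,-1). -/
def gN (x y : Fin 6 → ℝ) : ℝ := ∑ i : Fin 6, eps i * x i * y i

/-- The almost complex structure: J eᵢ = e_{i+3}, J e_{i+3} = −eᵢ (i = 1,2,3). -/
def JN (x : Fin 6 → ℝ) : Fin 6 → ℝ := ![-x 3, -x 4, -x 5, x 0, x 1, x 2]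

/-- The fundamental tensor F(x,y,z) = g((∇ₓJ)y, z) with ∇ₓy = (1/2)[x,y]. -/
def FT (l1 l2 l3 : ℝ) (x y z : Fin 6 → ℝ) : ℝ :=
  (1/2 : ℝ) * (gN (br l1 l2 l3 x (JN y)) z - gN (br l1 l2 l3 x y) (JN z))

/-- The (0,4)-curvature tensor R(x,y,z,u) = −(1/4)g([x,y],[z,u]). -/
def RT (l1 l2 l3 : ℝ) (x y z u : Fin 6 → ℝ) : ℝ :=
  -(1/4 : ℝ) * gN (br l1 l2 l3 x y) (br l1 l2 l3 z u)

/-- The Ricci tensor ρ(y,z) = Σᵢ εᵢ R(eᵢ,y,z,eᵢ). -/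
def ricT (l1 l2 l3 : ℝ) (y z : Fin 6 → ℝ) : ℝ :=
  ∑ i : Fin 6, eps i * RT l1 l2 l3 (e i) y z (e i)

/-- The sectional curvature of the plane spanned by x, y. -/
def kT (l1 l2 l3 : ℝ) (x y : Fin 6 → ℝ) : ℝ :=
  RT l1 l2 l3 x y y x / (gN x x * gN y y - gN x y ^ 2)

/-- The matrix of ad x : v ↦ [x,v]. -/
def adM (l1 l2 l3 : ℝ) (x : Fin 6 → ℝ) : Matrix (Fin 6) (Fin 6) ℝ :=
  Matrix.of fun k j => br l1 l2 l3 x (e j) k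

/-- The Killing form B(x,y) = tr(ad x ∘ ad y). -/
def KB (l1 l2 l3 : ℝ) (x y : Fin 6 → ℝ) : ℝ :=
  Matrix.trace (adM l1 l2 l3 x * adM l1 l2 l3 y)

theorem br_e_e (l1 l2 l3 : ℝ) (i j : Fin 6) : br l1 l2 l3 (e i) (e j) = tbl l1 l2 l3 i j := by
  funext k
  simp [br, e, Pi.single_apply]

theorem ricT_e_e (l1 l2 l3 : ℝ) (i j : Fin 6) :
    ricT l1 l2 l3 (e i) (e j) =
      ∑ m, eps m * (-(1 / 4) * gN (tbl l1 l2 l3 m i) (tbl l1 l2 l3 j m)) := by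
  simp only [ricT, RT, br_e_e]

/-- The components (26) of the Ricci tensor ρ for the Table 1 bracket. -/
theorem table1_ricci_components (l1 l2 l3 : ℝ) :
    (ricT l1 l2 l3 (e 0) (e 0) = -l3^2 ∧ ricT l1 l2 l3 (e 3) (e 3) = -l3^2 ∧
      ricT l1 l2 l3 (e 0) (e 3) = l3^2) ∧
    (ricT l1 l2 l3 (e 1) (e 1) = -l2^2 ∧ ricT l1 l2 l3 (e 4) (e 4) = -l2^2 ∧
      ricT l1 l2 l3 (e 1) (e 4) = l2^2) ∧
    (ricT l1 l2 l3 (e 2) (e 2) = -l1^2 ∧ ricT l1 l2 l3 (e 5) (e 5) = -l1^2 ∧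
      ricT l1 l2 l3 (e 2) (e 5) = l1^2) ∧
    (ricT l1 l2 l3 (e 0) (e 1) = l2*l3 ∧ ricT l1 l2 l3 (e 0) (e 4) = -(l2*l3) ∧
      ricT l1 l2 l3 (e 1) (e 3) = -(l2*l3) ∧ ricT l1 l2 l3 (e 3) (e 4) = l2*l3) ∧
    (ricT l1 l2 l3 (e 0) (e 2) = l1*l3 ∧ ricT l1 l2 l3 (e 0) (e 5) = -(l1*l3) ∧
      ricT l1 l2 l3 (e 2) (e 3) = -(l1*l3) ∧ ricT l1 l2 l3 (e 3) (e 5) = l1*l3) ∧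
    (ricT l1 l2 l3 (e 1) (e 2) = l1*l2 ∧ ricT l1 l2 l3 (e 1) (e 5) = -(l1*l2) ∧
      ricT l1 l2 l3 (e 2) (e 4) = -(l1*l2) ∧ ricT l1 l2 l3 (e 4) (e 5) = l1*l2) := by
  refine ⟨⟨?_, ?_, ?_⟩, ⟨?_, ?_, ?_⟩, ⟨?_, ?_, ?_⟩, ⟨?_, ?_, ?_, ?_⟩, ⟨?_, ?_, ?_, ?_⟩,
    ⟨?_, ?_, ?_, ?_⟩⟩ <;>
  · simp [ricT_e_e, gN, Fin.sum_univ_six, eps, tbl]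
    ring
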